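/- Assume every entry of φ* is strictly positive, with smallest entry φ*_min, and let C₀ denote the (convex) set of probability vectors satisfying the constraints exactly. Let δ be positive tolerances, ε > 0, 0 < θ ≤ 1/2, and α ∈ (0,1) with ψ(α,θ) = θ²/2 − α·θ·ln(m/(α·θ)) > 0. Define C₁ = (m−1)/ψ(α,θ) and C₂ = (m·ln 0.6 + (0.5·ln(2π) + 1/12 − 0.5·ln m)·m + ln((1/ε + 1)/0.249))/ψ(α,θ). Let n be an integer with n ≥ 100, n ≥ C₁·ln n + C₂, n ≥ 3m/(4·α·θ), n ≥ 1/θ∞, and n > 1/φ*_min, and let f* ∈ F_n satisfy ‖f* − φ*‖∞ ≤ 1/n and ‖f* − φ*‖₁ ≤ 3m/(4n). Then f* ∈ C(δ), ‖f* − φ*‖₁ ≤ α·θ, and #f* > (1/ε)·#{f ∈ F_n ∩ C₀ : ‖f − φ*‖₁ > θ}. -/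

import Mathlib

open scoped Classical
open BigOperators Finset

/-- Minimum absolute value of the entries of a vector `b`. -/
noncomputable def bAbsMin {k : ℕ} (b : Fin (k + 1) → ℝ) : ℝ := ⨅ i, |b i|

/-- Matrix infinity norm: maximum over rows of the sum of absolute values. -/
noncomputable def rowNorm {k m : ℕ} (A : Matrix (Fin (k + 1)) (Fin m) ℝ) : ℝ :=
  ⨆ i, ∑ j, |A i j|

/-- `x` satisfies the constraints to accuracy `δ = (deq, dle, deq0, dle0)`,
i.e. `x ∈ C(δ)`. -/
def InC {m ke kle ke0 kle0 : ℕ}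
    (Aeq : Matrix (Fin (ke + 1)) (Fin m) ℝ) (beq : Fin (ke + 1) → ℝ)
    (Ale : Matrix (Fin (kle + 1)) (Fin m) ℝ) (ble : Fin (kle + 1) → ℝ)
    (Aeq0 : Matrix (Fin (ke0 + 1)) (Fin m) ℝ)
    (Ale0 : Matrix (Fin (kle0 + 1)) (Fin m) ℝ)
    (deq dle deq0 dle0 : ℝ) (x : Fin m → ℝ) : Prop :=
  (∀ i, |Aeq.mulVec x i - beq i| ≤ deq * bAbsMin beq) ∧
  (∀ i, Ale.mulVec x i - ble i ≤ dle * bAbsMin ble) ∧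
  (∀ i, |Aeq0.mulVec x i| ≤ deq0) ∧
  (∀ i, Ale0.mulVec x i ≤ dle0)

/-- `x` satisfies the constraints exactly. -/
def ExactSat {m ke kle ke0 kle0 : ℕ}
    (Aeq : Matrix (Fin (ke + 1)) (Fin m) ℝ) (beq : Fin (ke + 1) → ℝ)
    (Ale : Matrix (Fin (kle + 1)) (Fin m) ℝ) (ble : Fin (kle + 1) → ℝ)
    (Aeq0 : Matrix (Fin (ke0 + 1)) (Fin m) ℝ)
    (Ale0 : Matrix (Fin (kle0 + 1)) (Fin m) ℝ)
    (x : Fin m → ℝ) : Prop :=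
  Aeq.mulVec x = beq ∧ (∀ i, Ale.mulVec x i ≤ ble i) ∧
  Aeq0.mulVec x = 0 ∧ (∀ i, Ale0.mulVec x i ≤ 0)

/-- The tolerance `θ∞` of Proposition 2. -/
noncomputable def thetaInf {m ke kle ke0 kle0 : ℕ}
    (Aeq : Matrix (Fin (ke + 1)) (Fin m) ℝ) (beq : Fin (ke + 1) → ℝ)
    (Ale : Matrix (Fin (kle + 1)) (Fin m) ℝ) (ble : Fin (kle + 1) → ℝ)
    (Aeq0 : Matrix (Fin (ke0 + 1)) (Fin m) ℝ)
    (Ale0 : Matrix (Fin (kle0 + 1)) (Fin m) ℝ)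
    (deq dle deq0 dle0 : ℝ) : ℝ :=
  min (min (deq * bAbsMin beq / rowNorm Aeq) (dle * bAbsMin ble / rowNorm Ale))
      (min (deq0 / rowNorm Aeq0) (dle0 / rowNorm Ale0))


/-! ### Helper lemmas -/

/-- Hoeffding's lemma for a Bernoulli variable. -/
lemma hoeffding_bernoulli (p s : ℝ) (hp0 : 0 ≤ p) (hp1 : p ≤ 1) :
    (1 - p) + p * Real.exp s ≤ Real.exp (p * s + s ^ 2 / 8) := by
  let μ : MeasureTheory.Measure Bool :=
    ENNReal.ofReal p • MeasureTheory.Measure.dirac true +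
      ENNReal.ofReal (1 - p) • MeasureTheory.Measure.dirac false
  have hprob : MeasureTheory.IsProbabilityMeasure μ := by
    constructor
    simp only [μ, MeasureTheory.Measure.add_apply, MeasureTheory.Measure.smul_apply,
      MeasureTheory.measure_univ, smul_eq_mul, mul_one]
    rw [← ENNReal.ofReal_add hp0 (by linarith)]
    simp
  have hint : ∀ g : Bool → ℝ, ∫ b, g b ∂μ = p * g true + (1 - p) * g false := by
    intro g
    have h1 : ∀ b, MeasureTheory.Integrable g (MeasureTheory.Measure.dirac b) := fun b =>
      MeasureTheory.Integrable.of_finite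
    rw [MeasureTheory.integral_add_measure ((h1 _).smul_measure (by simp))
      ((h1 _).smul_measure (by simp)), MeasureTheory.integral_smul_measure,
      MeasureTheory.integral_smul_measure]
    simp [ENNReal.toReal_ofReal hp0, ENNReal.toReal_ofReal (by linarith : (0:ℝ) ≤ 1 - p)]
  let X : Bool → ℝ := fun b => if b then 1 else 0
  have hX := ProbabilityTheory.hasSubgaussianMGF_of_mem_Icc (μ := μ) (X := X) (a := 0) (b := 1)
    (Measurable.of_discrete.aemeasurable)
    (Filter.Eventually.of_forall (by intro b; cases b <;> simp [X]))
  have h := hX.mgf_le s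
  rw [ProbabilityTheory.mgf, hint, hint] at h
  simp only [X] at h
  norm_num at h
  have e1 : (1 - p) + p * Real.exp s = Real.exp (p * s) *
      (p * Real.exp (s * (1 - p)) + (1 - p) * Real.exp (-(s * p))) := by
    have a1 : Real.exp (p * s) * Real.exp (s * (1 - p)) = Real.exp s := by
      rw [← Real.exp_add]; ring_nf
    have a2 : Real.exp (p * s) * Real.exp (-(s * p)) = 1 := by
      rw [← Real.exp_add]; ring_nf; simp
    linear_combination (-p) * a1 - (1 - p) * a2
  rw [e1, Real.exp_add]
  refine mul_le_mul_of_nonneg_left (h.trans (le_of_eq ?_)) (Real.exp_pos _).le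
  congr 1; ring

lemma log_factorial_upper (k : ℕ) (hk : 1 ≤ k) :
    Real.log (k.factorial : ℝ) ≤ k * Real.log k - k + Real.log k / 2 + 1 := by
  obtain ⟨j, rfl⟩ : ∃ j, k = j + 1 := ⟨k - 1, by omega⟩
  have h := Stirling.log_stirlingSeq'_antitone (Nat.zero_le j)
  simp only [Function.comp, Nat.succ_eq_add_one] at h
  have hk0 : (0 : ℝ) < ((j + 1 : ℕ) : ℝ) := by positivity
  rw [Stirling.log_stirlingSeq_formula, zero_add, Stirling.stirlingSeq_one,
    Real.log_div (Real.exp_pos _).ne' (by positivity), Real.log_exp, Real.log_sqrt (by norm_num),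
    Real.log_mul (by norm_num) hk0.ne', Real.log_div hk0.ne' (Real.exp_pos _).ne',
    Real.log_exp] at h
  linarith

/-- First-order optimality of the maximum-entropy vector. -/
lemma pythag {m : ℕ} (S : (Fin m → ℝ) → Prop) (φ f : Fin m → ℝ) (hφpos : ∀ i, 0 < φ i)
    (hφ1 : ∑ i, φ i = 1)
    (hopt : ∀ x : Fin m → ℝ, (∀ i, 0 ≤ x i) → ∑ i, x i = 1 → S x →
      -∑ i, x i * Real.log (x i) ≤ -∑ i, φ i * Real.log (φ i))
    (hf0 : ∀ i, 0 ≤ f i) (hf1 : ∑ i, f i = 1)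
    (hS : ∀ t : ℝ, 0 < t → t < 1 → S (fun i => φ i + t * (f i - φ i))) :
    -∑ i, f i * Real.log (φ i) ≤ -∑ i, φ i * Real.log (φ i) := by
  set c : ℝ := ∑ i, (f i - φ i) ^ 2 / φ i with hc
  set d : ℝ := ∑ i, (f i - φ i) * Real.log (φ i) with hd
  have hdd : d = ∑ i, f i * Real.log (φ i) - ∑ i, φ i * Real.log (φ i) := by
    rw [hd, ← Finset.sum_sub_distrib]; exact Finset.sum_congr rfl fun i _ => by ring
  have hc0 : 0 ≤ c := Finset.sum_nonneg fun i _ => div_nonneg (sq_nonneg _) (hφpos i).le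
  have key : ∀ t : ℝ, 0 < t → t < 1 → 0 ≤ d + t * c := by
    intro t ht0 ht1
    have hxpos : ∀ i, 0 < φ i + t * (f i - φ i) := fun i => by
      have : 0 < (1 - t) * φ i := mul_pos (by linarith) (hφpos i)
      nlinarith [mul_nonneg ht0.le (hf0 i)]
    have h := hopt (fun i => φ i + t * (f i - φ i)) (fun i => (hxpos i).le)
      (by rw [Finset.sum_add_distrib, ← Finset.mul_sum, Finset.sum_sub_distrib, hf1, hφ1]; ring)
      (hS t ht0 ht1)
    have h2 : ∑ i, (φ i + t * (f i - φ i)) * Real.log (φ i + t * (f i - φ i)) ≤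
        ∑ i, (φ i * Real.log (φ i) + t * ((f i - φ i) * Real.log (φ i)) + t * (f i - φ i)
          + t ^ 2 * ((f i - φ i) ^ 2 / φ i)) := by
      refine Finset.sum_le_sum fun i _ => ?_
      have hl := Real.log_le_sub_one_of_pos (div_pos (hxpos i) (hφpos i))
      rw [Real.log_div (hxpos i).ne' (hφpos i).ne'] at hl
      have h3 := mul_le_mul_of_nonneg_left hl (hxpos i).le
      have h4 : (φ i + t * (f i - φ i)) * ((φ i + t * (f i - φ i)) / φ i - 1) =
          t * (f i - φ i) + t ^ 2 * ((f i - φ i) ^ 2 / φ i) := by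
        have := (hφpos i).ne'
        field_simp
        ring
      rw [h4] at h3
      linarith
    rw [Finset.sum_add_distrib, Finset.sum_add_distrib, Finset.sum_add_distrib, ← Finset.mul_sum,
      ← Finset.mul_sum, ← Finset.mul_sum, ← hc, ← hd, Finset.sum_sub_distrib, hf1, hφ1] at h2
    have h5 : 0 ≤ t * (d + t * c) := by nlinarith
    exact nonneg_of_mul_nonneg_right h5 ht0
  have hd0 : 0 ≤ d := by
    by_contra hneg
    push Not at hneg
    have hc1 : 0 < c + 1 + (-d) := by linarith
    have h := key ((-d) / (c + 1 + (-d))) (div_pos (by linarith) hc1)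
      (by rw [div_lt_one hc1]; linarith)
    have h2 : (-d) / (c + 1 + (-d)) * c < -d := by
      rw [div_mul_eq_mul_div, div_lt_iff₀ hc1]
      nlinarith
    linarith
  linarith

/-- Continuity of entropy near `φ`. -/
lemma entropy_cont {m : ℕ} (hm : 2 ≤ m) (φ f : Fin m → ℝ) (hφpos : ∀ i, 0 < φ i)
    (hf0 : ∀ i, 0 < f i) (hf1 : ∀ i, f i ≤ 1) (hd : ∀ i, |f i - φ i| ≤ 1 / 100)
    (x : ℝ) (hx0 : 0 < x) (hx : x ≤ 1 / 2) (hl1 : ∑ i, |f i - φ i| ≤ x) :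
    -∑ i, φ i * Real.log (φ i) - x * Real.log (m / x) ≤ -∑ i, f i * Real.log (f i) := by
  have hm0 : (0 : ℝ) < m := by positivity
  have hm2 : (2 : ℝ) ≤ m := by exact_mod_cast hm
  have hL : 1 ≤ Real.log (m / x) := by
    rw [Real.le_log_iff_exp_le (by positivity)]
    have : (4 : ℝ) ≤ m / x := by rw [le_div_iff₀ hx0]; linarith
    linarith [Real.exp_one_lt_d9]
  have step : ∀ i, f i * Real.log (f i) - φ i * Real.log (φ i) ≤
      |f i - φ i| * Real.log (m / x) + (x / m - |f i - φ i|) := by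
    intro i
    have h1 : f i * Real.log (f i) - φ i * Real.log (φ i) ≤
        -(|f i - φ i| * Real.log |f i - φ i|) := by
      rcases lt_trichotomy (f i) (φ i) with h | h | h
      · rw [abs_of_neg (by linarith)]
        have a1 := Real.log_le_log (hf0 i) h.le
        have a2 := Real.log_le_log (show 0 < -(f i - φ i) by linarith)
          (show -(f i - φ i) ≤ φ i by linarith [hf0 i])
        nlinarith [mul_le_mul_of_nonneg_left a1 (hf0 i).le,
          mul_le_mul_of_nonneg_left a2 (show 0 ≤ -(f i - φ i) by linarith)]
      · simp [h]
      · have hd' := hd i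
        rw [abs_of_pos (by linarith)] at hd' ⊢
        have hdp : 0 < f i - φ i := by linarith
        have a1 := Real.log_le_sub_one_of_pos (div_pos (hf0 i) (hφpos i))
        rw [Real.log_div (hf0 i).ne' (hφpos i).ne'] at a1
        have a2 := mul_le_mul_of_nonneg_left a1 (hφpos i).le
        have a3 : φ i * (f i / φ i - 1) = f i - φ i := by
          have := (hφpos i).ne'
          field_simp
        have a4 : Real.log (f i) ≤ 0 := Real.log_nonpos (hf0 i).le (hf1 i)
        have a5 : Real.log (f i - φ i) ≤ -1 := by
          rw [Real.log_le_iff_le_exp hdp]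
          have : Real.exp (-1) * Real.exp 1 = 1 := by rw [← Real.exp_add]; simp
          nlinarith [Real.exp_one_lt_d9, Real.exp_pos (-1)]
        nlinarith [mul_nonneg hdp.le (show 0 ≤ -Real.log (f i) by linarith),
          mul_nonneg hdp.le (show 0 ≤ -1 - Real.log (f i - φ i) by linarith)]
    rcases (abs_nonneg (f i - φ i)).eq_or_lt with h0 | h0
    · rw [← h0] at h1 ⊢
      have : 0 < x / m := by positivity
      simp at h1 ⊢
      linarith
    · have a1 := Real.log_le_sub_one_of_pos (show 0 < x / m / |f i - φ i| by positivity)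
      rw [Real.log_div (by positivity) h0.ne', Real.log_div hx0.ne' hm0.ne'] at a1
      have a2 := mul_le_mul_of_nonneg_left a1 h0.le
      have a3 : |f i - φ i| * (x / m / |f i - φ i| - 1) = x / m - |f i - φ i| := by
        field_simp
      rw [Real.log_div hm0.ne' hx0.ne']
      nlinarith
  have hs := Finset.sum_le_sum fun i (_ : i ∈ Finset.univ) => step i
  rw [Finset.sum_sub_distrib, Finset.sum_add_distrib, ← Finset.sum_mul, Finset.sum_sub_distrib,
    Finset.sum_const, Finset.card_univ, Fintype.card_fin, nsmul_eq_mul,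
    mul_div_cancel₀ x hm0.ne'] at hs
  nlinarith [mul_nonneg (show 0 ≤ x - ∑ i, |f i - φ i| by linarith)
    (show 0 ≤ Real.log (m / x) - 1 by linarith)]

/-- Stirling lower bound for a multinomial coefficient. -/
lemma multinomial_lower {m n : ℕ} (hm : 2 ≤ m) (hn : 1 ≤ n) (ν : Fin m → ℕ) (hν : ∑ i, ν i = n)
    (hpos : ∀ i, 1 ≤ ν i) :
    n * (-∑ i, ((ν i : ℝ) / n) * Real.log ((ν i : ℝ) / n)) + Real.log n / 2
      + Real.log (2 * Real.pi) / 2 - m - m / 2 * Real.log n + m / 2 * Real.log m ≤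
      Real.log (Nat.multinomial Finset.univ ν : ℝ) := by
  have hm0 : (0 : ℝ) < m := by positivity
  have hn0 : (0 : ℝ) < n := by positivity
  have hν0 : ∀ i, (0 : ℝ) < ν i := fun i => by exact_mod_cast hpos i
  have hsum : ∑ i, (ν i : ℝ) = n := by exact_mod_cast hν
  have hspec := Nat.multinomial_spec Finset.univ ν
  rw [hν] at hspec
  have hspec' : (∏ i, ((ν i).factorial : ℝ)) * (Nat.multinomial Finset.univ ν : ℝ)
      = (n.factorial : ℝ) := by exact_mod_cast hspec
  have hmp : (0 : ℝ) < Nat.multinomial Finset.univ ν := by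
    exact_mod_cast Nat.multinomial_pos _ _
  have hlog : ∑ i, Real.log ((ν i).factorial : ℝ) + Real.log (Nat.multinomial Finset.univ ν : ℝ)
      = Real.log (n.factorial : ℝ) := by
    rw [← hspec', Real.log_mul (Finset.prod_ne_zero_iff.2 fun i _ => by positivity) hmp.ne',
      Real.log_prod (fun i _ => by positivity)]
  have h1 := Stirling.le_log_factorial_stirling (n := n) (by omega)
  have h2 : ∑ i, Real.log ((ν i).factorial : ℝ) ≤
      ∑ i, ((ν i : ℝ) * Real.log (ν i) - ν i + Real.log (ν i) / 2 + 1) :=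
    Finset.sum_le_sum fun i _ => log_factorial_upper _ (hpos i)
  have h3 : ∑ i, Real.log (ν i : ℝ) ≤ ∑ i, (Real.log n - Real.log m + (ν i * (m / n) - 1)) := by
    refine Finset.sum_le_sum fun i _ => ?_
    have := Real.log_le_sub_one_of_pos (show 0 < (ν i : ℝ) * (m / n) by have := hν0 i; positivity)
    rw [Real.log_mul (hν0 i).ne' (by positivity), Real.log_div hm0.ne' hn0.ne'] at this
    linarith
  rw [Finset.sum_add_distrib, Finset.sum_sub_distrib, Finset.sum_sub_distrib, ← Finset.sum_mul,
    hsum, mul_div_cancel₀ _ hn0.ne'] at h3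
  simp only [Finset.sum_const, Finset.card_univ, Fintype.card_fin, nsmul_eq_mul, mul_one] at h3
  rw [Finset.sum_add_distrib, Finset.sum_add_distrib, Finset.sum_sub_distrib, hsum,
    ← Finset.sum_div] at h2
  simp only [Finset.sum_const, Finset.card_univ, Fintype.card_fin, nsmul_eq_mul, mul_one] at h2
  have h4 : n * (-∑ i, ((ν i : ℝ) / n) * Real.log ((ν i : ℝ) / n)) =
      n * Real.log n - ∑ i, (ν i : ℝ) * Real.log (ν i) := by
    have e : (n : ℝ) * Real.log n = ∑ i, (ν i : ℝ) * Real.log n := by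
      rw [← Finset.sum_mul, hsum]
    rw [e, ← Finset.sum_sub_distrib, mul_neg, Finset.mul_sum, ← Finset.sum_neg_distrib]
    refine Finset.sum_congr rfl fun i _ => ?_
    rw [Real.log_div (hν0 i).ne' hn0.ne']
    field_simp
    ring
  rw [h4]
  linarith

/-- The ℓ1 concentration inequality. -/
lemma conc {m n : ℕ} (hn : 1 ≤ n) (φ : Fin m → ℝ) (hφpos : ∀ i, 0 < φ i) (hφ1 : ∑ i, φ i = 1)
    (θ : ℝ) (hθ : 0 < θ) (F : Finset (Fin m → ℕ)) (hF : ∀ ρ ∈ F, ∑ i, ρ i = n ∧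
      θ < ∑ i, |(ρ i : ℝ) / n - φ i|) :
    ∑ ρ ∈ F, (Nat.multinomial Finset.univ ρ : ℝ) * ∏ i, φ i ^ ρ i ≤
      2 ^ m * Real.exp (-(n * θ ^ 2 / 2)) := by
  have hn0 : (0 : ℝ) < n := by positivity
  set s : ℝ := 2 * θ with hs
  let w : Finset (Fin m) → (Fin m → ℕ) → ℝ := fun A ρ =>
    Real.exp (s * (∑ i ∈ A, (ρ i : ℝ) - n * (∑ i ∈ A, φ i + θ / 2)))
  let M : (Fin m → ℕ) → ℝ := fun ρ => (Nat.multinomial Finset.univ ρ : ℝ) * ∏ i, φ i ^ ρ i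
  have hM : ∀ ρ, 0 ≤ M ρ := fun ρ => mul_nonneg (Nat.cast_nonneg _)
    (Finset.prod_nonneg fun i _ => pow_nonneg (hφpos i).le _)
  have hw : ∀ ρ ∈ F, M ρ ≤ ∑ A, M ρ * w A ρ := by
    intro ρ hρ
    obtain ⟨h1, h2⟩ := hF ρ hρ
    have h1' : ∑ i, (ρ i : ℝ) = n := by exact_mod_cast h1
    let A := Finset.univ.filter fun i => φ i < (ρ i : ℝ) / n
    have hA : ∑ i, |(ρ i : ℝ) / n - φ i| = 2 * ∑ i ∈ A, ((ρ i : ℝ) / n - φ i) := by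
      have e0 : ∑ i, ((ρ i : ℝ) / n - φ i) = 0 := by
        rw [Finset.sum_sub_distrib, ← Finset.sum_div, h1', hφ1, div_self hn0.ne', sub_self]
      have e1 : ∑ i, |(ρ i : ℝ) / n - φ i| = ∑ i, |(ρ i : ℝ) / n - φ i| +
          ∑ i, ((ρ i : ℝ) / n - φ i) := by rw [e0, add_zero]
      rw [e1, ← Finset.sum_add_distrib, Finset.mul_sum, Finset.sum_filter]
      refine Finset.sum_congr rfl fun i _ => ?_
      split_ifs with h
      · rw [abs_of_pos (by linarith)]; ring
      · rw [abs_of_nonpos (by linarith)]; ring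
    have h3 : 1 ≤ w A ρ := by
      apply Real.one_le_exp
      apply mul_nonneg (by linarith)
      rw [hA, Finset.sum_sub_distrib, ← Finset.sum_div] at h2
      have h4 : (∑ i ∈ A, φ i + θ / 2) * n < ∑ i ∈ A, (ρ i : ℝ) := by
        rw [← lt_div_iff₀ hn0]; linarith
      linarith
    calc M ρ ≤ M ρ * w A ρ := le_mul_of_one_le_right (hM ρ) h3
      _ ≤ _ := Finset.single_le_sum (f := fun A => M ρ * w A ρ)
        (fun B _ => mul_nonneg (hM ρ) (Real.exp_pos _).le) (Finset.mem_univ A)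
  have hA : ∀ A : Finset (Fin m), ∑ ρ ∈ F, M ρ * w A ρ ≤ Real.exp (-(n * θ ^ 2 / 2)) := by
    intro A
    have h1 : ∑ ρ ∈ F, M ρ * w A ρ ≤ ∑ ρ ∈ Finset.piAntidiag Finset.univ n, M ρ * w A ρ := by
      apply Finset.sum_le_sum_of_subset_of_nonneg
      · intro ρ hρ
        simp [(hF ρ hρ).1]
      · intro ρ _ _
        exact mul_nonneg (hM ρ) (Real.exp_pos _).le
    let q : Fin m → ℝ := fun i => φ i * Real.exp (if i ∈ A then s else 0)
    have h2 : ∀ ρ, M ρ * w A ρ = Real.exp (-(s * (n * (∑ i ∈ A, φ i + θ / 2)))) *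
        ((Nat.multinomial Finset.univ ρ : ℝ) * ∏ i, q i ^ ρ i) := by
      intro ρ
      have e1 : ∏ i, q i ^ ρ i = (∏ i, φ i ^ ρ i) * Real.exp (s * ∑ i ∈ A, (ρ i : ℝ)) := by
        simp only [q, mul_pow]
        rw [Finset.prod_mul_distrib]
        congr 1
        simp only [← Real.exp_nat_mul]
        rw [← Real.exp_sum, Finset.mul_sum]
        congr 1
        rw [← Finset.sum_filter_add_sum_filter_not Finset.univ (fun i => i ∈ A)]
        rw [Finset.sum_congr rfl (g := fun i => s * (ρ i : ℝ)), Finset.sum_eq_zero (s := Finset.univ.filter fun i => ¬ i ∈ A), add_zero]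
        · congr 1; ext; simp
        · intro i hi; simp at hi; simp [hi]
        · intro i hi; simp at hi; simp [hi, mul_comm]
      rw [e1]
      simp only [M, w]
      rw [mul_sub, sub_eq_add_neg, Real.exp_add]
      ring
    have h3 : ∑ ρ ∈ Finset.piAntidiag Finset.univ n, M ρ * w A ρ =
        Real.exp (-(s * (n * (∑ i ∈ A, φ i + θ / 2)))) * (∑ i, q i) ^ n := by
      rw [Finset.sum_pow_eq_sum_piAntidiag, Finset.mul_sum]
      exact Finset.sum_congr rfl fun ρ _ => h2 ρ
    set p := ∑ i ∈ A, φ i with hp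
    have hp0 : 0 ≤ p := Finset.sum_nonneg fun i _ => (hφpos i).le
    have hcompl : p + ∑ i ∈ Aᶜ, φ i = 1 := by rw [hp, Finset.sum_add_sum_compl, hφ1]
    have hp1 : p ≤ 1 := by
      have : 0 ≤ ∑ i ∈ Aᶜ, φ i := Finset.sum_nonneg fun i _ => (hφpos i).le
      linarith
    have h4 : ∑ i, q i = (1 - p) + p * Real.exp s := by
      rw [← Finset.sum_add_sum_compl A]
      have e1 : ∑ i ∈ A, q i = p * Real.exp s := by
        rw [hp, Finset.sum_mul]
        exact Finset.sum_congr rfl fun i hi => by simp [q, hi]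
      have e2 : ∑ i ∈ Aᶜ, q i = ∑ i ∈ Aᶜ, φ i :=
        Finset.sum_congr rfl fun i hi => by simp [q, Finset.mem_compl.1 hi]
      rw [e1, e2]; linarith
    have h5 : (∑ i, q i) ^ n ≤ Real.exp (n * (p * s + s ^ 2 / 8)) := by
      rw [h4, Real.exp_nat_mul]
      apply pow_le_pow_left₀ _ (hoeffding_bernoulli p s hp0 hp1)
      have := Real.exp_pos s
      nlinarith
    refine h1.trans (h3.le.trans ((mul_le_mul_of_nonneg_left h5 (Real.exp_pos _).le).trans ?_))
    rw [← Real.exp_add]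
    apply Real.exp_le_exp.2
    rw [hs]
    apply le_of_eq
    ring
  calc ∑ ρ ∈ F, M ρ ≤ ∑ ρ ∈ F, ∑ A, M ρ * w A ρ := Finset.sum_le_sum hw
    _ = ∑ A, ∑ ρ ∈ F, M ρ * w A ρ := Finset.sum_comm
    _ ≤ ∑ A : Finset (Fin m), Real.exp (-(n * θ ^ 2 / 2)) := Finset.sum_le_sum fun A _ => hA A
    _ = _ := by simp

lemma row_bound {k m : ℕ} (A : Matrix (Fin (k + 1)) (Fin m) ℝ) (hA : A ≠ 0)
    (f φ : Fin m → ℝ) (η B : ℝ) (hη : 0 ≤ η) (h : ∀ i, |f i - φ i| ≤ η)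
    (hB : η ≤ B / rowNorm A) (i : Fin (k + 1)) :
    |A.mulVec f i - A.mulVec φ i| ≤ B := by
  have hbdd : BddAbove (Set.range fun i => ∑ j, |A i j|) := (Set.finite_range _).bddAbove
  have hle : ∀ i, ∑ j, |A i j| ≤ rowNorm A := fun i => le_ciSup hbdd i
  have hpos : 0 < rowNorm A := by
    by_contra hneg
    apply hA
    ext a b
    have h1 : |A a b| ≤ ∑ j, |A a j| :=
      Finset.single_le_sum (f := fun j => |A a j|) (fun j _ => abs_nonneg _) (Finset.mem_univ b)
    have h2 := hle a
    have : |A a b| = 0 := le_antisymm (by linarith) (abs_nonneg _)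
    simpa using this
  rw [le_div_iff₀ hpos] at hB
  refine le_trans ?_ hB
  have : A.mulVec f i - A.mulVec φ i = ∑ j, A i j * (f j - φ j) := by
    simp only [Matrix.mulVec, dotProduct]
    rw [← Finset.sum_sub_distrib]
    exact Finset.sum_congr rfl fun j _ => by ring
  rw [this]
  calc |∑ j, A i j * (f j - φ j)| ≤ ∑ j, |A i j * (f j - φ j)| := Finset.abs_sum_le_sum_abs _ _
    _ ≤ ∑ j, |A i j| * η := Finset.sum_le_sum fun j _ => by
        rw [abs_mul]; exact mul_le_mul_of_nonneg_left (h j) (abs_nonneg _)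
    _ = (∑ j, |A i j|) * η := by rw [Finset.sum_mul]
    _ ≤ rowNorm A * η := mul_le_mul_of_nonneg_right (hle i) hη
    _ = η * rowNorm A := mul_comm _ _

lemma rowNorm_pos {k m : ℕ} (A : Matrix (Fin (k + 1)) (Fin m) ℝ) (hA : A ≠ 0) :
    0 < rowNorm A := by
  have hbdd : BddAbove (Set.range fun i => ∑ j, |A i j|) := (Set.finite_range _).bddAbove
  by_contra hneg
  apply hA
  ext a b
  have h1 : |A a b| ≤ ∑ j, |A a j| :=
    Finset.single_le_sum (f := fun j => |A a j|) (fun j _ => abs_nonneg _) (Finset.mem_univ b)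
  have h2 : ∑ j, |A a j| ≤ rowNorm A := le_ciSup hbdd a
  have : |A a b| = 0 := le_antisymm (by linarith) (abs_nonneg _)
  simpa using this

lemma bAbsMin_pos {k : ℕ} (b : Fin (k + 1) → ℝ) (hb : ∀ i, b i ≠ 0) : 0 < bAbsMin b := by
  obtain ⟨i, hi⟩ := exists_eq_ciInf_of_finite (f := fun i => |b i|)
  unfold bAbsMin
  rw [← hi]
  exact abs_pos.2 (hb i)

set_option maxHeartbeats 2000000 in
/-- The MaxEnt vector itself, ℓ1 version (Lemma `cor:2` of the paper,
with `μ* = m`): under the stated conditions on `n`, any `f* ∈ F_n` with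
`‖f* − φ*‖∞ ≤ 1/n` and `‖f* − φ*‖₁ ≤ 3m/(4n)` lies in `C(δ)`, satisfies
`‖f* − φ*‖₁ ≤ αθ`, and has more than `1/ε` times the realizations of the whole set
of `f ∈ F_n ∩ C₀` with `‖f − φ*‖₁ > θ`. -/
theorem stmt_17 {m ke kle ke0 kle0 : ℕ} (hm : 2 ≤ m)
    (Aeq : Matrix (Fin (ke + 1)) (Fin m) ℝ) (beq : Fin (ke + 1) → ℝ)
    (Ale : Matrix (Fin (kle + 1)) (Fin m) ℝ) (ble : Fin (kle + 1) → ℝ)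
    (Aeq0 : Matrix (Fin (ke0 + 1)) (Fin m) ℝ)
    (Ale0 : Matrix (Fin (kle0 + 1)) (Fin m) ℝ)
    (hAeq : Aeq ≠ 0) (hAle : Ale ≠ 0) (hAeq0 : Aeq0 ≠ 0) (hAle0 : Ale0 ≠ 0)
    (hbeq : ∀ i, beq i ≠ 0) (hble : ∀ i, ble i ≠ 0)
    (deq dle deq0 dle0 : ℝ)
    (hdeq : 0 < deq) (hdle : 0 < dle) (hdeq0 : 0 < deq0) (hdle0 : 0 < dle0)
    (φ : Fin m → ℝ) (hφpos : ∀ i, 0 < φ i) (hφ1 : ∑ i, φ i = 1)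
    (hsat : ExactSat Aeq beq Ale ble Aeq0 Ale0 φ)
    (hopt : ∀ x : Fin m → ℝ, (∀ i, 0 ≤ x i) → ∑ i, x i = 1 →
      ExactSat Aeq beq Ale ble Aeq0 Ale0 x →
      -∑ i, x i * Real.log (x i) ≤ -∑ i, φ i * Real.log (φ i))
    (Hs : ℝ) (hHs : Hs = -∑ i, φ i * Real.log (φ i))
    (φmin : ℝ) (hφmin : (∃ i, φ i = φmin) ∧ ∀ i, φmin ≤ φ i)
    (ε : ℝ) (hε : 0 < ε)
    (θ : ℝ) (hθ0 : 0 < θ) (hθ : θ ≤ 1 / 2)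
    (α : ℝ) (hα : α ∈ Set.Ioo (0 : ℝ) 1)
    (ψ : ℝ) (hψdef : ψ = θ ^ 2 / 2 - α * θ * Real.log ((m : ℝ) / (α * θ)))
    (hψpos : 0 < ψ)
    (C₁ C₂ : ℝ)
    (hC₁ : C₁ = ((m : ℝ) - 1) / ψ)
    (hC₂ : C₂ = ((m : ℝ) * Real.log 0.6 +
        (0.5 * Real.log (2 * Real.pi) + 1 / 12 - 0.5 * Real.log (m : ℝ)) * (m : ℝ) +
        Real.log ((1 / ε + 1) / 0.249)) / ψ)
    (n : ℕ) (hn100 : 100 ≤ n)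
    (hnlog : C₁ * Real.log (n : ℝ) + C₂ ≤ (n : ℝ))
    (hnαθ : 3 * (m : ℝ) / (4 * α * θ) ≤ (n : ℝ))
    (hnθinf : 1 / thetaInf Aeq beq Ale ble Aeq0 Ale0 deq dle deq0 dle0 ≤ (n : ℝ))
    (hnφmin : 1 / φmin < (n : ℝ))
    (ν : Fin m → ℕ) (hν : ∑ i, ν i = n)
    (hinf : ∀ i, |(ν i : ℝ) / n - φ i| ≤ 1 / n)
    (hl1 : (∑ i, |(ν i : ℝ) / n - φ i|) ≤ 3 * (m : ℝ) / (4 * n)) :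
    InC Aeq beq Ale ble Aeq0 Ale0 deq dle deq0 dle0 (fun i => (ν i : ℝ) / n) ∧
    (∑ i, |(ν i : ℝ) / n - φ i|) ≤ α * θ ∧
    (1 / ε) * (∑ ρ ∈ (Finset.Nat.antidiagonalTuple m n).filter
        (fun ρ => ExactSat Aeq beq Ale ble Aeq0 Ale0 (fun i => (ρ i : ℝ) / n) ∧
          (∑ i, |(ρ i : ℝ) / n - φ i|) > θ),
        (Nat.multinomial Finset.univ ρ : ℝ)) <
      (Nat.multinomial Finset.univ ν : ℝ) := by
  obtain ⟨hα0, hα1⟩ := hα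
  have hn0 : (0 : ℝ) < n := by
    have : 0 < n := by omega
    exact_mod_cast this
  have hn100' : (100 : ℝ) ≤ n := by exact_mod_cast hn100
  have hm2 : (2 : ℝ) ≤ m := by exact_mod_cast hm
  have hx0 : 0 < α * θ := mul_pos hα0 hθ0
  have hl1' : (∑ i, |(ν i : ℝ) / n - φ i|) ≤ α * θ := by
    refine hl1.trans ?_
    rw [div_le_iff₀ (by positivity)] at hnαθ ⊢
    linarith
  refine ⟨?_, hl1', ?_⟩
  · set T := thetaInf Aeq beq Ale ble Aeq0 Ale0 deq dle deq0 dle0 with hT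
    have hTpos : 0 < T := by
      rw [hT, thetaInf]
      have := rowNorm_pos Aeq hAeq
      have := rowNorm_pos Ale hAle
      have := rowNorm_pos Aeq0 hAeq0
      have := rowNorm_pos Ale0 hAle0
      have := bAbsMin_pos beq hbeq
      have := bAbsMin_pos ble hble
      refine lt_min (lt_min ?_ ?_) (lt_min ?_ ?_) <;> positivity
    have hη : 1 / (n : ℝ) ≤ T := by
      rw [div_le_iff₀ hTpos] at hnθinf
      rw [div_le_iff₀ hn0]; linarith
    obtain ⟨s1, s2, s3, s4⟩ := hsat
    have hη0 : 0 ≤ 1 / (n : ℝ) := by positivity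
    refine ⟨fun i => ?_, fun i => ?_, fun i => ?_, fun i => ?_⟩
    · have := row_bound Aeq hAeq (fun i => (ν i : ℝ) / n) φ _ _ hη0 hinf
        (hη.trans ((min_le_left _ _).trans (min_le_left _ _))) i
      rwa [s1] at this
    · have := row_bound Ale hAle (fun i => (ν i : ℝ) / n) φ _ _ hη0 hinf
        (hη.trans ((min_le_left _ _).trans (min_le_right _ _))) i
      have := le_of_abs_le this
      linarith [s2 i]
    · have := row_bound Aeq0 hAeq0 (fun i => (ν i : ℝ) / n) φ _ _ hη0 hinf
        (hη.trans ((min_le_right _ _).trans (min_le_left _ _))) i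
      rw [s3] at this
      simpa using this
    · have := row_bound Ale0 hAle0 (fun i => (ν i : ℝ) / n) φ _ _ hη0 hinf
        (hη.trans ((min_le_right _ _).trans (min_le_right _ _))) i
      have := le_of_abs_le this
      linarith [s4 i]
  · set F := (Finset.Nat.antidiagonalTuple m n).filter
        (fun ρ => ExactSat Aeq beq Ale ble Aeq0 Ale0 (fun i => (ρ i : ℝ) / n) ∧
          (∑ i, |(ρ i : ℝ) / n - φ i|) > θ) with hF
    have hFm : ∀ ρ ∈ F, ∑ i, ρ i = n ∧ ExactSat Aeq beq Ale ble Aeq0 Ale0 (fun i => (ρ i : ℝ) / n) ∧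
          θ < ∑ i, |(ρ i : ℝ) / n - φ i| := by
      intro ρ hρ
      rw [hF, Finset.mem_filter, Finset.Nat.mem_antidiagonalTuple] at hρ
      exact ⟨hρ.1, hρ.2.1, hρ.2.2⟩
    have hconc := conc (by omega) φ hφpos hφ1 θ hθ0 F fun ρ hρ => ⟨(hFm ρ hρ).1, (hFm ρ hρ).2.2⟩
    -- each type in the far set weighs at least `exp (-n H*)`
    have hwt : ∀ ρ ∈ F, Real.exp (-(n * Hs)) ≤ ∏ i, φ i ^ ρ i := by
      intro ρ hρ
      obtain ⟨g1, g2, _⟩ := hFm ρ hρ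
      have g1' : ∑ i, (ρ i : ℝ) = n := by exact_mod_cast g1
      have hp := pythag (ExactSat Aeq beq Ale ble Aeq0 Ale0) φ (fun i => (ρ i : ℝ) / n) hφpos hφ1
        hopt (fun i => by positivity) (by rw [← Finset.sum_div, g1', div_self hn0.ne']) (by
          intro t ht0 ht1
          obtain ⟨s1, s2, s3, s4⟩ := hsat
          obtain ⟨r1, r2, r3, r4⟩ := g2
          have hfun : (fun i => φ i + t * ((ρ i : ℝ) / n - φ i)) =
              (1 - t) • φ + t • (fun i => (ρ i : ℝ) / n) := by
            ext i; simp; ring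
          rw [hfun]
          refine ⟨?_, fun i => ?_, ?_, fun i => ?_⟩
          · rw [Matrix.mulVec_add, Matrix.mulVec_smul, Matrix.mulVec_smul, s1, r1]
            ext i; simp; ring
          · rw [Matrix.mulVec_add, Matrix.mulVec_smul, Matrix.mulVec_smul]
            simp only [Pi.add_apply, Pi.smul_apply, smul_eq_mul]
            nlinarith [mul_le_mul_of_nonneg_left (s2 i) (by linarith : 0 ≤ 1 - t),
              mul_le_mul_of_nonneg_left (r2 i) ht0.le]
          · rw [Matrix.mulVec_add, Matrix.mulVec_smul, Matrix.mulVec_smul, s3, r3]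
            simp
          · rw [Matrix.mulVec_add, Matrix.mulVec_smul, Matrix.mulVec_smul]
            simp only [Pi.add_apply, Pi.smul_apply, smul_eq_mul]
            nlinarith [mul_le_mul_of_nonneg_left (s4 i) (by linarith : 0 ≤ 1 - t),
              mul_le_mul_of_nonneg_left (r4 i) ht0.le])
      rw [← hHs] at hp
      have e1 : ∏ i, φ i ^ ρ i = Real.exp (n * ∑ i, (ρ i : ℝ) / n * Real.log (φ i)) := by
        rw [Finset.mul_sum, Real.exp_sum]
        refine Finset.prod_congr rfl fun i _ => ?_
        rw [← mul_assoc, mul_div_cancel₀ _ hn0.ne', Real.exp_nat_mul, Real.exp_log (hφpos i)]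
      rw [e1]
      apply Real.exp_le_exp.2
      nlinarith
    have hfar : (∑ ρ ∈ F, (Nat.multinomial Finset.univ ρ : ℝ)) * Real.exp (-(n * Hs)) ≤
        2 ^ m * Real.exp (-(n * θ ^ 2 / 2)) := by
      refine le_trans ?_ hconc
      rw [Finset.sum_mul]
      exact Finset.sum_le_sum fun ρ hρ =>
        mul_le_mul_of_nonneg_left (hwt ρ hρ) (Nat.cast_nonneg _)
    have hfar' : (∑ ρ ∈ F, (Nat.multinomial Finset.univ ρ : ℝ)) ≤
        Real.exp (m * Real.log 2 + n * Hs - n * θ ^ 2 / 2) := by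
      have e : Real.exp (m * Real.log 2 + n * Hs - n * θ ^ 2 / 2) * Real.exp (-(n * Hs)) =
          2 ^ m * Real.exp (-(n * θ ^ 2 / 2)) := by
        rw [← Real.exp_add, show m * Real.log 2 + n * Hs - n * θ ^ 2 / 2 + -(n * Hs) =
          m * Real.log 2 + -(n * θ ^ 2 / 2) by ring, Real.exp_add, Real.exp_nat_mul,
          Real.exp_log (by norm_num)]
      rw [← e] at hfar
      exact le_of_mul_le_mul_right hfar (Real.exp_pos _)
    -- lower bound
    have hνpos : ∀ i, 1 ≤ ν i := by
      intro i
      by_contra h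
      have h0 : ν i = 0 := by omega
      have h1 := hinf i
      rw [h0, Nat.cast_zero, zero_div, zero_sub, abs_neg, abs_of_pos (hφpos i)] at h1
      obtain ⟨⟨j, hj⟩, hmin⟩ := hφmin
      have hmp : 0 < φmin := hj ▸ hφpos j
      rw [div_lt_iff₀ hmp] at hnφmin
      rw [le_div_iff₀ hn0] at h1
      nlinarith [hmin i]
    have hν1 : ∀ i, (ν i : ℝ) / n ≤ 1 := by
      intro i
      rw [div_le_one hn0, ← hν]
      exact_mod_cast Finset.single_le_sum (f := ν) (fun j _ => Nat.zero_le _) (Finset.mem_univ i)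
    have hent := entropy_cont hm φ (fun i => (ν i : ℝ) / n) hφpos
      (fun i => div_pos (by exact_mod_cast hνpos i) hn0) hν1
      (fun i => (hinf i).trans (one_div_le_one_div_of_le (by norm_num) hn100')) (α * θ) hx0
      ((mul_le_of_le_one_left hθ0.le hα1.le).trans hθ) hl1'
    rw [← hHs] at hent
    have hlow := multinomial_lower hm (by omega) ν hν hνpos
    have hent' := mul_le_mul_of_nonneg_left hent hn0.le
    have hnψ : ((m : ℝ) - 1) * Real.log n + ((m : ℝ) * Real.log 0.6 +
        (0.5 * Real.log (2 * Real.pi) + 1 / 12 - 0.5 * Real.log (m : ℝ)) * (m : ℝ) +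
        Real.log ((1 / ε + 1) / 0.249)) ≤ n * ψ := by
      rw [hC₁, hC₂, div_mul_eq_mul_div, ← add_div, div_le_iff₀ hψpos] at hnlog
      exact hnlog
    have hε' : 0 < 1 / ε := by positivity
    rw [Real.log_div (by positivity) (by norm_num)] at hnψ
    have c1 : Real.log (1 / ε) ≤ Real.log (1 / ε + 1) := Real.log_le_log hε' (by linarith)
    have c2 : Real.log 0.249 ≤ -(2 * Real.log 2) := by
      have : -(2 * Real.log 2) = Real.log (1 / 4) := by
        rw [one_div, Real.log_inv, show (4 : ℝ) = 2 ^ 2 by norm_num, Real.log_pow]; norm_num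
      rw [this]
      exact Real.log_le_log (by norm_num) (by norm_num)
    have c3 : -(2 / 3) ≤ Real.log 0.6 := by
      have := Real.one_sub_inv_le_log_of_pos (show (0 : ℝ) < 0.6 by norm_num)
      norm_num at this ⊢
      linarith
    have c4 : 1 ≤ Real.log (2 * Real.pi) := by
      rw [Real.le_log_iff_exp_le (by positivity)]
      linarith [Real.exp_one_lt_d9, Real.pi_gt_three]
    have c5 : 4 ≤ Real.log n := by
      rw [Real.le_log_iff_exp_le hn0]
      have : Real.exp 4 = Real.exp 1 ^ 4 := by rw [← Real.exp_nat_mul]; norm_num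
      rw [this]
      have : Real.exp 1 ^ 4 ≤ 3 ^ 4 :=
        pow_le_pow_left₀ (Real.exp_pos _).le (by linarith [Real.exp_one_lt_d9]) 4
      linarith
    have c6 := Real.log_two_lt_d9
    have c7 := Real.log_two_gt_d9
    have d1 := mul_le_mul_of_nonneg_left c3 (by linarith : (0 : ℝ) ≤ m)
    have d2 := mul_le_mul_of_nonneg_left c4 (by linarith : (0 : ℝ) ≤ m)
    have d3 := mul_le_mul_of_nonneg_left c5 (by linarith : (0 : ℝ) ≤ m - 1)
    have d4 := mul_le_mul_of_nonneg_left c6.le (by linarith : (0 : ℝ) ≤ m)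
    have hfinal : Real.log (1 / ε) + (m * Real.log 2 + n * Hs - n * θ ^ 2 / 2) <
        Real.log (Nat.multinomial Finset.univ ν : ℝ) := by
      refine lt_of_lt_of_le ?_ hlow
      rw [hψdef] at hnψ
      norm_num at hnψ hent' c1 c2 c3 d1 ⊢
      linarith
    have hmp : (0 : ℝ) < Nat.multinomial Finset.univ ν := by
      exact_mod_cast Nat.multinomial_pos _ _
    have e1 : (1 / ε) * Real.exp (m * Real.log 2 + n * Hs - n * θ ^ 2 / 2) =
        Real.exp (Real.log (1 / ε) + (m * Real.log 2 + n * Hs - n * θ ^ 2 / 2)) := by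
      rw [Real.exp_add, Real.exp_log hε']
    have e2 := Real.exp_lt_exp.2 hfinal
    rw [Real.exp_log hmp, ← e1] at e2
    exact lt_of_le_of_lt (mul_le_mul_of_nonneg_left hfar' hε'.le) e2
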